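/- arXiv:2409.03599 — 2 statements merged into one kernel-verified Lean document; each statement's English description precedes it below -/
import Mathlib

section
/- Let H : ℝ² → ℝ be a smooth ℤ²-periodic function, let u = ∇⊥H = (−∂₂H, ∂₁H), let T > 0 and κ > 0, and let θ : [0,T]×ℝ² → ℝ be a classical solution of the advection–diffusion equation with velocity u, diffusivity κ and initial datum H. Then κ ∫₀^T ∫_{[0,1]²} |∇θ(t,x)|² dx dt ≤ κ T ∫_{[0,1]²} |∇H(x)|² dx; in particular the dissipation κ ∫₀^T ∫_{[0,1]²} |∇θ|² dx dt tends to 0 as κ → 0 (no anomalous dissipation for the initial datum H). -/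
open MeasureTheory

noncomputable section

/-- The plane `ℝ²` as a Euclidean space. -/
abbrev E2 := EuclideanSpace ℝ (Fin 2)

/-- `ℤ²`-periodicity of a function on `ℝ²`. -/
def Per {F : Type*} [AddCommGroup F] (f : E2 → F) : Prop :=
  ∀ (x : E2) (k : Fin 2 → ℤ),
    f (x + (WithLp.equiv 2 (Fin 2 → ℝ)).symm (fun i => (k i : ℝ))) = f x

/-- The periodicity cell `[0,1]²`, identified with the torus `𝕋²`. -/
def cube : Set E2 := {x | ∀ i, x i ∈ Set.Icc (0:ℝ) 1}

/-- The Laplacian of a function on `ℝ²`: sum of second partial derivatives. -/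
def lap (f : E2 → ℝ) (x : E2) : ℝ :=
  ∑ i : Fin 2, fderiv ℝ (fun y => fderiv ℝ f y (EuclideanSpace.single i 1)) x
    (EuclideanSpace.single i 1)

/-- A classical solution of the advection–diffusion equation
`∂ₜθ + u·∇θ = κ Δθ`, `θ(0,·) = θin` on `[0,T] × ℝ²`. -/
def IsClassicalSolution (T κ : ℝ) (u : E2 → E2) (θin : E2 → ℝ) (θ : ℝ → E2 → ℝ) : Prop :=
  (∃ C, ∀ t x, |θ t x| ≤ C) ∧
  (∀ t, Per (θ t)) ∧
  ContinuousOn (fun p : ℝ × E2 => θ p.1 p.2) (Set.Icc 0 T ×ˢ (Set.univ : Set E2)) ∧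
  (∀ x : E2, ∀ t ∈ Set.Ioc 0 T, DifferentiableAt ℝ (fun s => θ s x) t) ∧
  ContinuousOn (fun p : ℝ × E2 => deriv (fun s => θ s p.2) p.1)
    (Set.Ioc 0 T ×ˢ (Set.univ : Set E2)) ∧
  (∀ t ∈ Set.Ioc 0 T, ContDiff ℝ 2 (θ t)) ∧
  (∀ t ∈ Set.Ioc 0 T, ∀ x, deriv (fun s => θ s x) t + fderiv ℝ (θ t) x (u x) = κ * lap (θ t) x) ∧
  (∀ x, θ 0 x = θin x)

/-- The perpendicular gradient `∇⊥H = (−∂₂H, ∂₁H)` of a Hamiltonian `H : ℝ² → ℝ`. -/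
def perpGrad (H : E2 → ℝ) (x : E2) : E2 :=
  EuclideanSpace.single (0 : Fin 2) (-(fderiv ℝ H x (EuclideanSpace.single (1 : Fin 2) 1))) +
  EuclideanSpace.single (1 : Fin 2) (fderiv ℝ H x (EuclideanSpace.single (0 : Fin 2) 1))

/-- The squared operator norm of a linear functional on the plane is the sum of its squared
coordinates. -/
lemma norm_sq_functional (L : E2 →L[ℝ] ℝ) :
    ‖L‖ ^ 2 = L (EuclideanSpace.single 0 1) ^ 2 + L (EuclideanSpace.single 1 1) ^ 2 := by
  rw [(EuclideanSpace.basisFun (Fin 2) ℝ).norm_dual]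
  simp [Fin.sum_univ_two]

lemma cube_eq_preimage : cube = (fun x : E2 => WithLp.ofLp x) ⁻¹' Set.Icc 0 1 := by
  ext x
  simp [cube, Pi.le_def, forall_and]

lemma isCompact_cube : IsCompact cube := by
  rw [cube_eq_preimage]
  exact (EuclideanSpace.equiv (Fin 2) ℝ).toHomeomorph.isCompact_preimage.2 isCompact_Icc

lemma Per.fderiv {f : E2 → ℝ} (hf : Per f) (v : E2) : Per (fun x => fderiv ℝ f x v) := by
  intro x k
  have := fderiv_comp_add_right (𝕜 := ℝ) (f := f) (x := x)
    ((WithLp.equiv 2 (Fin 2 → ℝ)).symm (fun i => (k i : ℝ)))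
  simp only [hf _ k] at this
  simp only [this]

lemma perpGrad_eq (H : E2 → ℝ) (x : E2) :
    perpGrad H x =
      (-(fderiv ℝ H x (EuclideanSpace.single 1 1))) • EuclideanSpace.single (0 : Fin 2) (1 : ℝ) +
        (fderiv ℝ H x (EuclideanSpace.single 0 1)) • EuclideanSpace.single (1 : Fin 2) (1 : ℝ) := by
  ext i
  fin_cases i <;> simp [perpGrad]

/-- The divergence of a periodic `C¹` vector field has zero mean. -/
lemma integral_div_eq_zero (V : Fin 2 → E2 → ℝ) (hV : ∀ i, ContDiff ℝ 1 (V i))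
    (hper : ∀ i, Per (V i)) :
    ∫ x in cube, ∑ i, fderiv ℝ (V i) x (EuclideanSpace.single i 1) = 0 := by
  have hcont : Continuous fun x => ∑ i, fderiv ℝ (V i) x (EuclideanSpace.single i 1) :=
    continuous_finsetSum _ fun i _ => ((hV i).continuous_fderiv one_ne_zero).clm_apply continuous_const
  have hmp := PiLp.volume_preserving_toLp (Fin 2)
  have hpre : (WithLp.toLp 2 : (Fin 2 → ℝ) → E2) ⁻¹' cube = Set.Icc 0 1 := by
    rw [cube_eq_preimage]; rfl
  rw [← hmp.setIntegral_preimage_emb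
    (MeasurableEquiv.toLp 2 (Fin 2 → ℝ)).measurableEmbedding, hpre]
  let J := (PiLp.continuousLinearEquiv 2 ℝ (fun _ : Fin 2 => ℝ)).symm
  have key := integral_divergence_of_hasFDerivAt_off_countable' (n := 1) (E := ℝ)
    (a := 0) (b := 1) zero_le_one (fun i x => V i (WithLp.toLp 2 x))
    (fun i x => (fderiv ℝ (V i) (WithLp.toLp 2 x)).comp (J : (Fin 2 → ℝ) →L[ℝ] E2)) ∅
    Set.countable_empty
    (fun i => ((hV i).continuous.comp (PiLp.continuous_toLp 2 _)).continuousOn)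
    (fun x _ i => (((hV i).differentiable one_ne_zero _).hasFDerivAt (x := J x)).comp x
      (J : (Fin 2 → ℝ) →L[ℝ] E2).hasFDerivAt)
    ((hcont.comp (PiLp.continuous_toLp 2 _)).continuousOn.integrableOn_compact isCompact_Icc)
  refine key.trans (Finset.sum_eq_zero fun i _ => sub_eq_zero.2 (integral_congr_ae ?_))
  refine Filter.Eventually.of_forall fun x => ?_
  have := hper i (WithLp.toLp 2 (i.insertNth 0 x)) (Pi.single i 1)
  refine Eq.trans ?_ this
  dsimp only
  congr 1
  ext j
  refine Fin.succAboveCases i ?_ (fun j => ?_) j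
  · simp
  · simp

/-- Energy inequality at a fixed time: if `g` solves `g + ∇⊥H·∇f = κ Δf` then
`∫ (f - H) g` is controlled by the Dirichlet energies of `H` and `f`. -/
lemma integral_sub_mul_le {H f g : E2 → ℝ} {κ : ℝ} (hκ : 0 < κ) (hH : ContDiff ℝ 2 H)
    (hHper : Per H) (hf : ContDiff ℝ 2 f) (hfper : Per f)
    (hg : ∀ x, g x + fderiv ℝ f x (perpGrad H x) = κ * lap f x) :
    ∫ x in cube, (f x - H x) * g x ≤
      κ / 2 * (∫ x in cube, ‖fderiv ℝ H x‖ ^ 2) - κ / 2 * ∫ x in cube, ‖fderiv ℝ f x‖ ^ 2 := by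
  have hd : ∀ {h : E2 → ℝ}, ContDiff ℝ 2 h → ∀ i : Fin 2,
      ContDiff ℝ 1 fun x => fderiv ℝ h x (EuclideanSpace.single i 1) := fun hh i =>
    (hh.fderiv_right (by norm_num)).clm_apply contDiff_const
  have hn : ∀ {h : E2 → ℝ}, ContDiff ℝ 2 h →
      IntegrableOn (fun x => ‖fderiv ℝ h x‖ ^ 2) cube := fun hh =>
    ((hh.continuous_fderiv two_ne_zero).norm.pow 2).continuousOn.integrableOn_compact
      isCompact_cube
  let V : Fin 2 → E2 → ℝ := ![
    fun x => κ * ((f x - H x) * fderiv ℝ f x (EuclideanSpace.single 0 1)) +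
      1 / 2 * (fderiv ℝ H x (EuclideanSpace.single 1 1) * (f x - H x) ^ 2),
    fun x => κ * ((f x - H x) * fderiv ℝ f x (EuclideanSpace.single 1 1)) -
      1 / 2 * (fderiv ℝ H x (EuclideanSpace.single 0 1) * (f x - H x) ^ 2)]
  have hw : ContDiff ℝ 1 (fun x => f x - H x) := (hf.sub hH).of_le (by norm_num)
  have hV : ∀ i, ContDiff ℝ 1 (V i) := by
    intro i
    fin_cases i
    · exact (contDiff_const.mul (hw.mul (hd hf 0))).add
        (contDiff_const.mul ((hd hH 1).mul (hw.pow 2)))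
    · exact (contDiff_const.mul (hw.mul (hd hf 1))).sub
        (contDiff_const.mul ((hd hH 0).mul (hw.pow 2)))
  have hVper : ∀ i, Per (V i) := by
    intro i x k
    have h1 := fun v => hfper.fderiv v x k
    have h2 := fun v => hHper.fderiv v x k
    simp only at h1 h2
    fin_cases i <;> simp [V, -WithLp.equiv_symm_apply, h1, h2, hfper x k, hHper x k]
  have hdiv : ∀ x, ∑ i, fderiv ℝ (V i) x (EuclideanSpace.single i 1) =
      (f x - H x) * g x + κ * ∑ i : Fin 2, (fderiv ℝ f x (EuclideanSpace.single i 1) -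
        fderiv ℝ H x (EuclideanSpace.single i 1)) *
          fderiv ℝ f x (EuclideanSpace.single i 1) := by
    intro x
    have hsymm : fderiv ℝ (fun y => fderiv ℝ H y (EuclideanSpace.single 1 1)) x
          (EuclideanSpace.single 0 1) =
        fderiv ℝ (fun y => fderiv ℝ H y (EuclideanSpace.single 0 1)) x
          (EuclideanSpace.single 1 1) := by
      have hdd : DifferentiableAt ℝ (fderiv ℝ H) x :=
        (hH.fderiv_right (m := 1) (by norm_num)).differentiable one_ne_zero x
      rw [fderiv_clm_apply hdd (differentiableAt_const _),
        fderiv_clm_apply hdd (differentiableAt_const _)]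
      simpa using (hH.contDiffAt.isSymmSndFDerivAt (by simp)).eq
        (EuclideanSpace.single 0 1) (EuclideanSpace.single 1 1)
    have hF := ((hf.differentiable two_ne_zero) x).hasFDerivAt
    have hHd := ((hH.differentiable two_ne_zero) x).hasFDerivAt
    have hW := hF.sub hHd
    have hf' := fun i => ((hd hf i).differentiable one_ne_zero x).hasFDerivAt
    have hH' := fun i => ((hd hH i).differentiable one_ne_zero x).hasFDerivAt
    have e0 : HasFDerivAt (V 0) _ x := ((hW.mul (hf' 0)).const_mul κ).add
      (((hH' 1).mul (hW.pow 2)).const_mul (1 / 2))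
    have e1 : HasFDerivAt (V 1) _ x := ((hW.mul (hf' 1)).const_mul κ).sub
      (((hH' 0).mul (hW.pow 2)).const_mul (1 / 2))
    have hgx := hg x
    rw [perpGrad_eq, map_add, map_smul, map_smul, lap, Fin.sum_univ_two] at hgx
    rw [Fin.sum_univ_two, Fin.sum_univ_two, e0.fderiv, e1.fderiv]
    simp only [smul_eq_mul, add_apply, sub_apply,
      smul_apply, Pi.sub_apply, nsmul_eq_mul] at hgx ⊢
    simp only [Nat.reduceSub, pow_one, Nat.cast_ofNat, hsymm]
    linear_combination -(f x - H x) * hgx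
  have h0 := integral_div_eq_zero V hV hVper
  have hVint : IntegrableOn (fun x => ∑ i, fderiv ℝ (V i) x (EuclideanSpace.single i 1)) cube :=
    (continuous_finsetSum _ fun i _ => ((hV i).continuous_fderiv one_ne_zero).clm_apply
      continuous_const).continuousOn.integrableOn_compact isCompact_cube
  have hgc : Continuous g := by
    have hlap : Continuous (lap f) := continuous_finsetSum _ fun i _ =>
      ((hd hf i).continuous_fderiv one_ne_zero).clm_apply continuous_const
    have hp : Continuous (perpGrad H) := by
      rw [funext (perpGrad_eq H)]
      exact ((hd hH 1).continuous.neg.smul continuous_const).add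
        ((hd hH 0).continuous.smul continuous_const)
    have : g = fun x => κ * lap f x - fderiv ℝ f x (perpGrad H x) :=
      funext fun x => eq_sub_of_add_eq (hg x)
    rw [this]
    exact (continuous_const.mul hlap).sub
      ((hf.continuous_fderiv two_ne_zero).clm_apply hp)
  have hwg : IntegrableOn (fun x => (f x - H x) * g x) cube :=
    (hw.continuous.mul hgc).continuousOn.integrableOn_compact isCompact_cube
  have hdiff : Integrable (fun x => κ / 2 * ‖fderiv ℝ H x‖ ^ 2 - κ / 2 * ‖fderiv ℝ f x‖ ^ 2)
      (volume.restrict cube) := ((hn hH).const_mul _).sub ((hn hf).const_mul _)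
  have hmono : ∫ x in cube, (f x - H x) * g x ≤
      ∫ x in cube, ((∑ i, fderiv ℝ (V i) x (EuclideanSpace.single i 1)) +
        (κ / 2 * ‖fderiv ℝ H x‖ ^ 2 - κ / 2 * ‖fderiv ℝ f x‖ ^ 2)) := by
    refine integral_mono hwg (hVint.add hdiff) fun x => ?_
    simp only [hdiv, norm_sq_functional, Fin.sum_univ_two]
    nlinarith [mul_nonneg hκ.le (sq_nonneg (fderiv ℝ f x (EuclideanSpace.single 0 1) -
        fderiv ℝ H x (EuclideanSpace.single 0 1))),
      mul_nonneg hκ.le (sq_nonneg (fderiv ℝ f x (EuclideanSpace.single 1 1) -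
        fderiv ℝ H x (EuclideanSpace.single 1 1)))]
  rwa [integral_add hVint hdiff, h0, zero_add, integral_sub ((hn hH).const_mul _) ((hn hf).const_mul _), integral_const_mul,
    integral_const_mul] at hmono

/-- **No anomalous dissipation for the initial datum `H`.**
If `u = ∇⊥H` with `H` smooth and `ℤ²`-periodic, then any classical solution of the
advection–diffusion equation with velocity `u`, diffusivity `κ > 0` and initial datum `H`
satisfies `κ ∫₀ᵀ ∫ |∇θ|² ≤ κ T ∫ |∇H|²`. -/
theorem no_anomalous_dissipation_for_hamiltonian_datum
    (H : E2 → ℝ) (hH : ContDiff ℝ (⊤ : ℕ∞) H) (hHper : Per H)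
    (T κ : ℝ) (hT : 0 < T) (hκ : 0 < κ)
    (θ : ℝ → E2 → ℝ)
    (hθ : IsClassicalSolution T κ (perpGrad H) H θ) :
    κ * ∫ t in Set.Icc (0:ℝ) T, ∫ x in cube, ‖fderiv ℝ (θ t) x‖ ^ 2 ≤
      κ * T * ∫ x in cube, ‖fderiv ℝ H x‖ ^ 2 := by
  obtain ⟨⟨C, hC⟩, hper, hcont, hdiff, hdcont, hC2, hpde, h0⟩ := hθ
  have hH2 : ContDiff ℝ 2 H := hH.of_le (WithTop.coe_le_coe.2 le_top)
  set A := ∫ x in cube, ‖fderiv ℝ H x‖ ^ 2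
  have hA0 : 0 ≤ A := integral_nonneg fun x => by positivity
  obtain ⟨M, hM⟩ := isCompact_cube.exists_bound_of_continuousOn hH.continuous.continuousOn
  have hcube : MeasurableSet cube := isCompact_cube.measurableSet
  have : IsFiniteMeasure (volume.restrict cube) :=
    ⟨by simpa using isCompact_cube.measure_lt_top⟩
  have hbd : ∀ t, ∀ x ∈ cube, |θ t x - H x| ≤ C + M := fun t x hx =>
    (abs_sub _ _).trans (add_le_add (hC t x) (hM x hx))
  have hθx : ∀ t ∈ Set.Icc 0 T, Continuous (θ t) := fun t ht =>
    hcont.comp_continuous (f := fun x : E2 => (t, x)) (by fun_prop) fun x => ⟨ht, Set.mem_univ x⟩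
  let F : ℝ → ℝ := fun t => ∫ x in cube, (θ t x - H x) ^ 2
  have hFcont : ContinuousOn F (Set.Icc 0 T) := by
    refine continuousOn_of_dominated (bound := fun _ => (C + M) ^ 2) (fun t ht =>
      (((hθx t ht).sub hH.continuous).pow 2).aestronglyMeasurable) (fun t _ => ?_)
      (integrable_const _) (Filter.Eventually.of_forall fun x => ?_)
    · filter_upwards [ae_restrict_mem hcube] with x hx
      rw [Real.norm_eq_abs, abs_pow]
      exact pow_le_pow_left₀ (abs_nonneg _) (hbd t x hx) 2
    · exact ((hcont.comp (f := fun t : ℝ => (t, x)) (by fun_prop)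
        fun t ht => ⟨ht, Set.mem_univ x⟩).sub continuousOn_const).pow 2
  have hFderiv : ∀ t ∈ Set.Ioo 0 T, HasDerivAt F
      (∫ x in cube, 2 * ((θ t x - H x) * deriv (fun s => θ s x) t)) t := by
    intro t ht
    obtain ⟨a, ha0, hat⟩ := exists_between ht.1
    have hsub : Set.Icc a T ⊆ Set.Ioc 0 T := fun s hs => ⟨ha0.trans_le hs.1, hs.2⟩
    obtain ⟨D, hD⟩ := (isCompact_Icc.prod isCompact_cube).exists_bound_of_continuousOn
      (hdcont.mono (Set.prod_mono hsub (Set.subset_univ cube)))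
    have hdx : Continuous fun x => deriv (fun s => θ s x) t :=
      hdcont.comp_continuous (f := fun x : E2 => (t, x)) (by fun_prop)
        fun x => ⟨⟨ht.1, ht.2.le⟩, Set.mem_univ x⟩
    have hsq : ∀ s ∈ Set.Icc 0 T, Continuous fun x => (θ s x - H x) ^ 2 := fun s hs =>
      ((hθx s hs).sub hH.continuous).pow 2
    refine (hasDerivAt_integral_of_dominated_loc_of_deriv_le
      (F' := fun s x => 2 * ((θ s x - H x) * deriv (fun r => θ r x) s))
      (bound := fun _ => 2 * ((C + M) * D)) (Icc_mem_nhds hat ht.2) ?_ ?_ ?_ ?_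
      (integrable_const _) ?_).2
    · filter_upwards [Icc_mem_nhds ht.1 ht.2] with s hs using (hsq s hs).aestronglyMeasurable
    · exact (hsq t ⟨ht.1.le, ht.2.le⟩).continuousOn.integrableOn_compact isCompact_cube
    · exact (continuous_const.mul
        (((hθx t ⟨ht.1.le, ht.2.le⟩).sub hH.continuous).mul hdx)).aestronglyMeasurable
    · filter_upwards [ae_restrict_mem hcube] with x hx s hs
      rw [Real.norm_eq_abs, abs_mul, abs_mul, abs_two]
      have h1 := hbd s x hx
      exact mul_le_mul_of_nonneg_left (mul_le_mul h1 (hD (s, x) ⟨hs, hx⟩) (abs_nonneg _)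
        ((abs_nonneg _).trans h1)) zero_le_two
    · refine Filter.Eventually.of_forall fun x s hs => ?_
      have := ((hdiff x s (hsub hs)).hasDerivAt.sub_const (H x)).pow 2
      convert! this using 1
      simp
      ring
  by_cases hint : IntegrableOn (fun t => ∫ x in cube, ‖fderiv ℝ (θ t) x‖ ^ 2) (Set.Icc 0 T)
  · have hφ : IntegrableOn (fun t => κ * (∫ x in cube, ‖fderiv ℝ (θ t) x‖ ^ 2) - κ * A)
        (Set.Icc 0 T) :=
      (hint.const_mul κ).sub (integrable_const _)
    have key := intervalIntegral.integral_le_sub_of_hasDeriv_right_of_le hT.le hFcont.neg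
      (fun t ht => (hFderiv t ht).neg.hasDerivWithinAt) hφ fun t ht => by
        have ht' : t ∈ Set.Ioc 0 T := ⟨ht.1, ht.2.le⟩
        have := integral_sub_mul_le hκ hH2 hHper (hC2 t ht') (hper t) (hpde t ht')
        rw [integral_const_mul]
        linarith
    have hF0 : F 0 = 0 := by simp [F, h0]
    have hFT : 0 ≤ F T := integral_nonneg fun x => sq_nonneg _
    rw [intervalIntegral.integral_of_le hT.le, ← integral_Icc_eq_integral_Ioc,
      integral_sub (hint.const_mul κ) (integrable_const _), integral_const_mul] at key
    simp [hF0, hT.le] at key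
    linarith
  · rw [integral_undef hint, mul_zero]
    positivity

end
end

section
/- Distributional divergence of the enlarging rotating pipe: Let 0 < r < R, v > 0 and λ ≥ 1. Set α = v/√λ, r' = √λ r, R' = √λ R, and let u_α : ℝ² → ℝ² be defined by u_α(x,y) = (α/√(x²+y²))·(y, −x) if r'² ≤ x²+y² ≤ R'², and (0,0) otherwise. Define w : ℝ² → ℝ² by w(x,y) = ( √λ · u_α^{(1)}(x/√λ, √λ·y), (1/√λ) · u_α^{(2)}(x/√λ, √λ·y) ) for (x,y) ∈ [0, λR] × [0, R], and w(x,y) = (0,0) otherwise. Then for every smooth compactly supported φ : ℝ² → ℝ: ∫_{ℝ²} w(x,y) · ∇φ(x,y) dx dy = − v ∫_r^R φ(0, y) dy + (v/λ) ∫_{λr}^{λR} φ(x, 0) dx. In other words, the distributional divergence of w is v·H¹ restricted to the segment {0}×[r,R] minus (v/λ)·H¹ restricted to the segment [λr, λR]×{0}. -/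
open MeasureTheory

noncomputable section

/-- The rotating-annulus velocity field `u_α`: equal to `(α/√(x²+y²))·(y, −x)` on the annulus
`r'² ≤ x² + y² ≤ R'²` and `0` elsewhere. -/
def rotField (r' R' α : ℝ) (z : E2) : E2 :=
  if r' ^ 2 ≤ (z 0) ^ 2 + (z 1) ^ 2 ∧ (z 0) ^ 2 + (z 1) ^ 2 ≤ R' ^ 2 then
    (α / Real.sqrt ((z 0) ^ 2 + (z 1) ^ 2)) •
      (EuclideanSpace.single (0 : Fin 2) (z 1) + EuclideanSpace.single (1 : Fin 2) (-(z 0)))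
  else 0

/-- The enlarging rotating pipe `w`: the anisotropic rescaling
`w(x,y) = (√λ u_α⁽¹⁾(x/√λ, √λ y), (1/√λ) u_α⁽²⁾(x/√λ, √λ y))` of the rotating-annulus field
with `α = v/√λ`, `r' = √λ r`, `R' = √λ R`, restricted to the rectangle `[0, λR] × [0, R]`. -/
def pipeField (r R v lam : ℝ) (z : E2) : E2 :=
  if z 0 ∈ Set.Icc 0 (lam * R) ∧ z 1 ∈ Set.Icc 0 R then
    (WithLp.equiv 2 (Fin 2 → ℝ)).symm
      ![Real.sqrt lam *
          rotField (Real.sqrt lam * r) (Real.sqrt lam * R) (v / Real.sqrt lam)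
            ((WithLp.equiv 2 (Fin 2 → ℝ)).symm ![z 0 / Real.sqrt lam, Real.sqrt lam * z 1]) 0,
        (1 / Real.sqrt lam) *
          rotField (Real.sqrt lam * r) (Real.sqrt lam * R) (v / Real.sqrt lam)
            ((WithLp.equiv 2 (Fin 2 → ℝ)).symm ![z 0 / Real.sqrt lam, Real.sqrt lam * z 1]) 1]
  else 0

/-- The point of the plane with scaled polar coordinates `(ρ, θ)`, namely
`(s ρ cos θ, ρ sin θ / s)`. -/
def scaledPolar (s ρ θ : ℝ) : E2 := !₂[s * (ρ * Real.cos θ), s⁻¹ * (ρ * Real.sin θ)]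

/-- The angular derivative of `scaledPolar`. -/
def scaledPolarDeriv (s ρ θ : ℝ) : E2 := !₂[s * (ρ * -Real.sin θ), s⁻¹ * (ρ * Real.cos θ)]

lemma hasDerivAt_scaledPolar (s ρ θ : ℝ) :
    HasDerivAt (scaledPolar s ρ) (scaledPolarDeriv s ρ θ) θ := by
  have h : HasDerivAt (fun θ => ![s * (ρ * Real.cos θ), s⁻¹ * (ρ * Real.sin θ)])
      ![s * (ρ * -Real.sin θ), s⁻¹ * (ρ * Real.cos θ)] θ := by
    rw [hasDerivAt_pi]
    intro i
    fin_cases i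
    · exact ((Real.hasDerivAt_cos θ).const_mul ρ).const_mul s
    · exact ((Real.hasDerivAt_sin θ).const_mul ρ).const_mul s⁻¹
  exact (PiLp.hasFDerivAt_toLp (𝕜 := ℝ) 2 _).comp_hasDerivAt θ h

lemma continuous_scaledPolar (s : ℝ) : Continuous fun p : ℝ × ℝ => scaledPolar s p.1 p.2 := by
  refine (PiLp.continuous_toLp 2 _).comp (continuous_pi fun i => ?_)
  fin_cases i <;> simp <;> fun_prop

lemma continuous_scaledPolarDeriv (s : ℝ) :
    Continuous fun p : ℝ × ℝ => scaledPolarDeriv s p.1 p.2 := by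
  refine (PiLp.continuous_toLp 2 _).comp (continuous_pi fun i => ?_)
  fin_cases i <;> simp <;> fun_prop

/-- An anisotropic scaling of the plane with determinant one preserves area. -/
lemma measurePreserving_scaling {s : ℝ} (hs : 0 < s) :
    MeasurePreserving (fun p : ℝ × ℝ => (s * p.1, s⁻¹ * p.2)) := by
  refine ⟨by fun_prop, ?_⟩
  have h := Measure.map_prod_map (volume : Measure ℝ) (volume : Measure ℝ)
    (measurable_const_mul s) (measurable_const_mul s⁻¹)
  rw [Real.map_volume_mul_left hs.ne', Real.map_volume_mul_left (inv_pos.2 hs).ne',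
    Measure.prod_smul_left, Measure.prod_smul_right, smul_smul, inv_inv,
    abs_of_pos hs, abs_of_pos (inv_pos.2 hs), ← ENNReal.ofReal_mul (inv_pos.2 hs).le,
    inv_mul_cancel₀ hs.ne', ENNReal.ofReal_one, one_smul] at h
  exact h.symm

/-- Integration over the plane in scaled polar coordinates. -/
lemma integral_eq_integral_scaledPolar {s : ℝ} (hs : 0 < s) (f : E2 → ℝ) :
    ∫ z, f z = ∫ p in polarCoord.target, p.1 * f (scaledPolar s p.1 p.2) := by
  have h₁ := (EuclideanSpace.volume_preserving_symm_measurableEquiv_toLp (Fin 2)).symm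
    |>.integral_comp' f
  have h₂ := (volume_preserving_finTwoArrow ℝ).symm.integral_comp'
    (fun x : Fin 2 → ℝ => f (WithLp.toLp 2 x))
  have hemb : MeasurableEmbedding (fun p : ℝ × ℝ => (s * p.1, s⁻¹ * p.2)) :=
    (measurableEmbedding_mulLeft₀ hs.ne').prodMap
      (measurableEmbedding_mulLeft₀ (inv_pos.2 hs).ne')
  have h₃ := (measurePreserving_scaling hs).integral_comp hemb
    (fun p : ℝ × ℝ => f !₂[p.1, p.2])
  have h₄ := integral_comp_polarCoord_symm (fun p : ℝ × ℝ => f !₂[s * p.1, s⁻¹ * p.2])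
  calc ∫ z, f z = ∫ x : Fin 2 → ℝ, f (WithLp.toLp 2 x) := h₁.symm
    _ = ∫ p : ℝ × ℝ, f !₂[p.1, p.2] := h₂.symm
    _ = ∫ p : ℝ × ℝ, f !₂[s * p.1, s⁻¹ * p.2] := h₃.symm
    _ = _ := h₄.symm

lemma rotField_of_mem {r' R' α : ℝ} {z : E2}
    (h : r' ^ 2 ≤ z 0 ^ 2 + z 1 ^ 2 ∧ z 0 ^ 2 + z 1 ^ 2 ≤ R' ^ 2) :
    rotField r' R' α z = !₂[α / √(z 0 ^ 2 + z 1 ^ 2) * z 1, -(α / √(z 0 ^ 2 + z 1 ^ 2) * z 0)] := by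
  rw [rotField, if_pos h]
  ext i
  fin_cases i <;> simp

/-- In scaled polar coordinates the pipe field is purely angular, of constant speed. -/
lemma pipeField_scaledPolar {r R v lam ρ θ : ℝ} (hr : 0 < r) (hlam : 0 < lam)
    (hρ : ρ ∈ Set.Icc (√lam * r) (√lam * R)) (hθ : θ ∈ Set.Icc 0 (Real.pi / 2)) :
    ρ • pipeField r R v lam (scaledPolar √lam ρ θ) =
      (-(v / √lam)) • scaledPolarDeriv √lam ρ θ := by
  have hs : 0 < √lam := Real.sqrt_pos.2 hlam
  have hss : √lam * √lam = lam := Real.mul_self_sqrt hlam.le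
  have hρ0 : 0 < ρ := (mul_pos hs hr).trans_le hρ.1
  have hc : 0 ≤ Real.cos θ := Real.cos_nonneg_of_mem_Icc ⟨by linarith [hθ.1, Real.pi_pos], hθ.2⟩
  have hsn : 0 ≤ Real.sin θ :=
    Real.sin_nonneg_of_mem_Icc ⟨hθ.1, by linarith [hθ.2, Real.pi_pos]⟩
  have hcρ : ρ * Real.cos θ ≤ √lam * R :=
    (mul_le_of_le_one_right hρ0.le (Real.cos_le_one θ)).trans hρ.2
  have hsρ : ρ * Real.sin θ ≤ √lam * R :=
    (mul_le_of_le_one_right hρ0.le (Real.sin_le_one θ)).trans hρ.2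
  have hmem : scaledPolar √lam ρ θ 0 ∈ Set.Icc 0 (lam * R) ∧
      scaledPolar √lam ρ θ 1 ∈ Set.Icc 0 R := by
    simp only [scaledPolar, PiLp.toLp_apply, Matrix.cons_val_zero, Matrix.cons_val_one]
    refine ⟨⟨by positivity, ?_⟩, by positivity, ?_⟩
    · calc √lam * (ρ * Real.cos θ) ≤ √lam * (√lam * R) := by gcongr
        _ = lam * R := by rw [← mul_assoc, hss]
    · rwa [inv_mul_le_iff₀ hs]
  have hz : (WithLp.equiv 2 (Fin 2 → ℝ)).symm ![scaledPolar √lam ρ θ 0 / √lam,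
      √lam * scaledPolar √lam ρ θ 1] = !₂[ρ * Real.cos θ, ρ * Real.sin θ] := by
    ext i
    fin_cases i <;> simp [scaledPolar] <;> field_simp
  have hn : (ρ * Real.cos θ) ^ 2 + (ρ * Real.sin θ) ^ 2 = ρ ^ 2 := by
    linear_combination ρ ^ 2 * Real.cos_sq_add_sin_sq θ
  have hann : (√lam * r) ^ 2 ≤ (!₂[ρ * Real.cos θ, ρ * Real.sin θ] : E2) 0 ^ 2 +
        (!₂[ρ * Real.cos θ, ρ * Real.sin θ] : E2) 1 ^ 2 ∧
      (!₂[ρ * Real.cos θ, ρ * Real.sin θ] : E2) 0 ^ 2 +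
        (!₂[ρ * Real.cos θ, ρ * Real.sin θ] : E2) 1 ^ 2 ≤ (√lam * R) ^ 2 := by
    simp only [Matrix.cons_val_zero, Matrix.cons_val_one, hn]
    exact ⟨pow_le_pow_left₀ (by positivity) hρ.1 2, pow_le_pow_left₀ hρ0.le hρ.2 2⟩
  rw [pipeField, if_pos hmem, hz, rotField_of_mem hann]
  ext i
  fin_cases i
  · simp [scaledPolarDeriv, hn, Real.sqrt_sq hρ0.le]
    field_simp
  · simp [scaledPolarDeriv, hn, Real.sqrt_sq hρ0.le]
    field_simp

lemma pipeField_scaledPolar_eq_zero {r R v lam ρ θ : ℝ} (hr : 0 < r) (hrR : r < R)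
    (hlam : 0 < lam) (hρ : 0 < ρ) (hθ : θ ∈ Set.Ioo (-Real.pi) Real.pi)
    (h : ¬(ρ ∈ Set.Icc (√lam * r) (√lam * R) ∧ θ ∈ Set.Icc 0 (Real.pi / 2))) :
    pipeField r R v lam (scaledPolar √lam ρ θ) = 0 := by
  have hs : 0 < √lam := Real.sqrt_pos.2 hlam
  by_cases hmem : scaledPolar √lam ρ θ 0 ∈ Set.Icc 0 (lam * R) ∧
      scaledPolar √lam ρ θ 1 ∈ Set.Icc 0 R
  swap
  · rw [pipeField, if_neg hmem]
  have hc : 0 ≤ Real.cos θ := by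
    have h₀ : 0 ≤ √lam * (ρ * Real.cos θ) := by simpa [scaledPolar] using hmem.1.1
    exact nonneg_of_mul_nonneg_right (nonneg_of_mul_nonneg_right h₀ hs) hρ
  have hsn : 0 ≤ Real.sin θ := by
    have h₀ : 0 ≤ (√lam)⁻¹ * (ρ * Real.sin θ) := by simpa [scaledPolar] using hmem.2.1
    exact nonneg_of_mul_nonneg_right (nonneg_of_mul_nonneg_right h₀ (inv_pos.2 hs)) hρ
  have hθ' : θ ∈ Set.Icc 0 (Real.pi / 2) := by
    constructor
    · by_contra! hlt
      exact hsn.not_gt (Real.sin_neg_of_neg_of_neg_pi_lt hlt hθ.1)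
    · by_contra! hlt
      exact hc.not_gt (Real.cos_neg_of_pi_div_two_lt_of_lt hlt (by linarith [hθ.2, Real.pi_pos]))
  have hz : (WithLp.equiv 2 (Fin 2 → ℝ)).symm ![scaledPolar √lam ρ θ 0 / √lam,
      √lam * scaledPolar √lam ρ θ 1] = !₂[ρ * Real.cos θ, ρ * Real.sin θ] := by
    ext i
    fin_cases i <;> simp [scaledPolar] <;> field_simp
  have hn : (ρ * Real.cos θ) ^ 2 + (ρ * Real.sin θ) ^ 2 = ρ ^ 2 := by
    linear_combination ρ ^ 2 * Real.cos_sq_add_sin_sq θ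
  have hrot : rotField (√lam * r) (√lam * R) (v / √lam)
      !₂[ρ * Real.cos θ, ρ * Real.sin θ] = 0 := by
    rw [rotField, if_neg]
    simp only [Matrix.cons_val_zero, Matrix.cons_val_one, hn]
    rintro ⟨h₁, h₂⟩
    have hR : 0 ≤ √lam * R := by have := hr.trans hrR; positivity
    exact h ⟨⟨le_of_sq_le_sq h₁ hρ.le, le_of_sq_le_sq h₂ hR⟩, hθ'⟩
  rw [pipeField, if_pos hmem, hz, hrot]
  ext i
  fin_cases i <;> simp

/-- **Distributional divergence of the enlarging rotating pipe.**
For every smooth compactly supported test function `φ`,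
`∫ w·∇φ = −v ∫_r^R φ(0,y) dy + (v/λ) ∫_{λr}^{λR} φ(x,0) dx`; that is,
`div w = v·H¹|_{{0}×[r,R]} − (v/λ)·H¹|_{[λr,λR]×{0}}`. -/
theorem pipeField_distributional_divergence (r R v lam : ℝ)
    (hr : 0 < r) (hrR : r < R) (hv : 0 < v) (hlam : 1 ≤ lam) :
    ∀ φ : E2 → ℝ, ContDiff ℝ (⊤ : ℕ∞) φ → HasCompactSupport φ →
      (∫ z : E2, fderiv ℝ φ z (pipeField r R v lam z)) =
        - v * (∫ y in r..R, φ (EuclideanSpace.single (1 : Fin 2) y)) +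
          (v / lam) * ∫ x in (lam * r)..(lam * R), φ (EuclideanSpace.single (0 : Fin 2) x) := by
  intro φ hφ _
  have hlam0 : 0 < lam := one_pos.trans_le hlam
  have hs : 0 < √lam := Real.sqrt_pos.2 hlam0
  have hss : √lam * √lam = lam := Real.mul_self_sqrt hlam0.le
  have hle : √lam * r ≤ √lam * R := by gcongr
  have hπ := Real.pi_pos
  set K : Set (ℝ × ℝ) := Set.Icc (√lam * r) (√lam * R) ×ˢ Set.Icc 0 (Real.pi / 2)
  set F : ℝ × ℝ → ℝ := fun p =>
    fderiv ℝ φ (scaledPolar √lam p.1 p.2) (scaledPolarDeriv √lam p.1 p.2)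
  have hF : Continuous F :=
    ((hφ.continuous_fderiv (by simp)).comp (continuous_scaledPolar _)).clm_apply
      (continuous_scaledPolarDeriv _)
  have hK : K ⊆ polarCoord.target := by
    rintro ⟨ρ, θ⟩ ⟨hρ, hθ⟩
    exact ⟨(mul_pos hs hr).trans_le hρ.1, by linarith [hθ.1], by linarith [hθ.2]⟩
  have hφc : Continuous φ := hφ.continuous
  have hφ_single (i : Fin 2) : Continuous fun t : ℝ => φ (EuclideanSpace.single i t) := by
    refine hφc.comp ((PiLp.continuous_toLp 2 _).comp ?_)
    exact continuous_single (A := fun _ : Fin 2 => ℝ) i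
  have hinner (ρ : ℝ) : ∫ θ in Set.Icc 0 (Real.pi / 2), F (ρ, θ) =
      φ (EuclideanSpace.single 1 (ρ / √lam)) - φ (EuclideanSpace.single 0 (√lam * ρ)) := by
    rw [integral_Icc_eq_integral_Ioc, ← intervalIntegral.integral_of_le (by positivity),
      intervalIntegral.integral_eq_sub_of_hasDerivAt (f := fun θ => φ (scaledPolar √lam ρ θ))
        ?_ ?_]
    · have h₁ : scaledPolar √lam ρ (Real.pi / 2) = EuclideanSpace.single 1 (ρ / √lam) := by
        ext i
        fin_cases i
        · simp [scaledPolar]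
        · simp [scaledPolar, div_eq_inv_mul ρ]
      have h₂ : scaledPolar √lam ρ 0 = EuclideanSpace.single 0 (√lam * ρ) := by
        ext i
        fin_cases i <;> simp [scaledPolar]
      simp only [h₁, h₂]
    · intro θ _
      exact ((hφ.differentiable (by simp)) _).hasFDerivAt.comp_hasDerivAt θ
        (hasDerivAt_scaledPolar _ ρ θ)
    · exact (hF.comp (by fun_prop : Continuous fun θ : ℝ => (ρ, θ))).intervalIntegrable _ _
  have hvol : ∫ p in K, F p = (∫ ρ in (√lam * r)..(√lam * R),
        φ (EuclideanSpace.single 1 (ρ / √lam))) -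
      ∫ ρ in (√lam * r)..(√lam * R), φ (EuclideanSpace.single 0 (√lam * ρ)) := by
    have hint : IntegrableOn F K (volume.prod volume) :=
      hF.continuousOn.integrableOn_compact (isCompact_Icc.prod isCompact_Icc)
    rw [Measure.volume_eq_prod, setIntegral_prod _ hint]
    simp only [hinner]
    rw [integral_Icc_eq_integral_Ioc, ← intervalIntegral.integral_of_le hle,
      intervalIntegral.integral_sub]
    · exact ((hφ_single 1).comp (by fun_prop : Continuous fun ρ => ρ / √lam)).intervalIntegrable _ _
    · exact ((hφ_single 0).comp (by fun_prop : Continuous fun ρ => √lam * ρ)).intervalIntegrable _ _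
  have hpolar : ∫ z : E2, fderiv ℝ φ z (pipeField r R v lam z) =
      -(v / √lam) * ∫ p in K, F p := by
    rw [integral_eq_integral_scaledPolar hs, ← integral_const_mul,
      setIntegral_eq_of_subset_of_forall_sdiff_eq_zero
        polarCoord.open_target.measurableSet hK]
    · refine setIntegral_congr_fun (measurableSet_Icc.prod measurableSet_Icc) ?_
      rintro ⟨ρ, θ⟩ ⟨hρ, hθ⟩
      simp only [F]
      rw [← smul_eq_mul, ← map_smul, pipeField_scaledPolar hr hlam0 hρ hθ, map_smul, smul_eq_mul]
    · rintro ⟨ρ, θ⟩ ⟨⟨hρ, hθ⟩, h⟩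
      rw [pipeField_scaledPolar_eq_zero hr hrR hlam0 hρ hθ h, map_zero, mul_zero]
  rw [hpolar, hvol,
    intervalIntegral.integral_comp_div (fun y => φ (EuclideanSpace.single 1 y)) hs.ne',
    intervalIntegral.integral_comp_mul_left (fun x => φ (EuclideanSpace.single 0 x)) hs.ne',
    mul_div_cancel_left₀ _ hs.ne', mul_div_cancel_left₀ _ hs.ne', ← mul_assoc, ← mul_assoc, hss,
    smul_eq_mul, smul_eq_mul]
  nth_rw 6 [← hss]
  field_simp
  ring

end
end
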